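/- Let Q₁, Q₁' : ℝ⁹ → ℝ⁹ be as in the context. Then Q₁' ∘ Q₁ = id_{ℝ⁹} and Q₁ ∘ Q₁' = id_{ℝ⁹}; in particular Q₁ is a piecewise-linear bijection of ℝ⁹ with inverse Q₁'. -/

import Mathlib

/-- The `max`-tropicalisation of the pullback action of `σ₁⁻¹` of `Gr(4,8)` on the
ŷ-variables of the initial seed, realizing the action of `σ₁` on g-vectors. -/
noncomputable def Q1 : (Fin 9 → ℝ) → (Fin 9 → ℝ) := fun v =>
  ![-v 1 - max 0 (v 2),
    v 5 + max 0 (v 8) + max 0 (max (v 1) (v 1 + v 2))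
      - max 0 (max (v 2) (max (v 2 + v 5) (v 2 + v 5 + v 8))),
    max 0 (v 2) - v 2 - v 5 - max 0 (v 8),
    v 0 + max 0 (v 3) + max 0 (max (v 1) (v 1 + v 2)),
    v 1 + v 3 + v 4 + v 8 + max 0 (v 2) - max 0 (v 3) - max 0 (v 8)
      - max 0 (max (v 1) (v 1 + v 2)),
    max 0 (max (v 2) (max (v 2 + v 5) (v 2 + v 5 + v 8))) - v 8 - max 0 (v 2),
    v 3 + v 6 - max 0 (v 3),
    -v 3,
    v 7 + max 0 (v 3) + max 0 (v 8)]

/-- The `max`-tropicalisation of the pullback action of `σ₁` of `Gr(4,8)` on the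
ŷ-variables of the initial seed, realizing the action of `σ₁⁻¹` on g-vectors. -/
noncomputable def Q1' : (Fin 9 → ℝ) → (Fin 9 → ℝ) := fun v =>
  ![v 0 + v 3 + v 7 - max 0 (v 0) - max 0 (v 7),
    v 1 + max 0 (v 2) - max 0 (max (v 0) (max (v 0 + v 1) (v 0 + v 1 + v 2))),
    max 0 (v 0) - v 0 - v 1 - max 0 (v 2),
    -v 7,
    v 4 + max 0 (v 0) + max 0 (v 7) + max 0 (max (v 2) (v 2 + v 5)) - max 0 (v 2),
    v 5 + max 0 (max (v 0) (max (v 0 + v 1) (v 0 + v 1 + v 2))) - max 0 (v 0)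
      - max 0 (max (v 2) (v 2 + v 5)),
    v 6 + max 0 (v 7),
    v 2 + v 5 + v 7 + v 8 - max 0 (v 7) - max 0 (max (v 2) (v 2 + v 5)),
    max 0 (v 2) - v 2 - v 5]

theorem max_zero_max_add (a b : ℝ) : max 0 (max a (a + b)) = max 0 (a + max 0 b) := by
  grind

theorem max_zero_neg (a : ℝ) : max 0 (-a) = max 0 a - a := by
  grind

theorem max_zero_max_max_add (a b c : ℝ) :
    max 0 (max a (max (a + b) (a + b + c))) = max 0 (a + max 0 (b + max 0 c)) := by
  grind

theorem Q1'_Q1 (v : Fin 9 → ℝ) : Q1' (Q1 v) = v := by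
  have hA := max_zero_max_add (v 1) (v 2)
  have hB := max_zero_max_max_add (v 2) (v 5) (v 8)
  generalize eA : max 0 (max (v 1) (v 1 + v 2)) = A at *
  generalize eB : max 0 (max (v 2) (max (v 2 + v 5) (v 2 + v 5 + v 8))) = B at *
  have h0 : max 0 (-v 1 - max 0 (v 2)) = A - v 1 - max 0 (v 2) := by grind
  have h2 : max 0 (max 0 (v 2) - v 2 - v 5 - max 0 (v 8)) = B - v 2 - v 5 - max 0 (v 8) := by
    grind
  have hM : max 0 (max (-v 1 - max 0 (v 2))
      (max (-v 1 - max 0 (v 2) + (v 5 + max 0 (v 8) + A - B))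
        (-v 1 - max 0 (v 2) + (v 5 + max 0 (v 8) + A - B)
          + (max 0 (v 2) - v 2 - v 5 - max 0 (v 8))))) = A - v 1 - v 2 := by
    rw [max_zero_max_max_add, h2]
    clear h0 h2 eA eB
    grind (splits := 20)
  have hN : max 0 (max (max 0 (v 2) - v 2 - v 5 - max 0 (v 8))
      (max 0 (v 2) - v 2 - v 5 - max 0 (v 8) + (B - v 8 - max 0 (v 2))))
      = B - v 2 - v 5 - v 8 := by
    rw [max_zero_max_add]
    clear h0 h2 hM hA eA eB
    grind (splits := 20)
  ext i
  fin_cases i <;> simp [Q1, Q1', eA, eB, h0, h2, max_zero_neg, hM, hN] <;> ring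

theorem Q1_Q1' (v : Fin 9 → ℝ) : Q1 (Q1' v) = v := by
  have hM := max_zero_max_max_add (v 0) (v 1) (v 2)
  have hN := max_zero_max_add (v 2) (v 5)
  generalize eM : max 0 (max (v 0) (max (v 0 + v 1) (v 0 + v 1 + v 2))) = M at *
  generalize eN : max 0 (max (v 2) (v 2 + v 5)) = N at *
  have h2 : max 0 (max 0 (v 0) - v 0 - v 1 - max 0 (v 2)) = M - v 0 - v 1 - max 0 (v 2) := by
    grind
  have h8 : max 0 (max 0 (v 2) - v 2 - v 5) = N - v 2 - v 5 := by grind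
  have hA : max 0 (max (v 1 + max 0 (v 2) - M)
      (v 1 + max 0 (v 2) - M + (max 0 (v 0) - v 0 - v 1 - max 0 (v 2))))
      = max 0 (v 0) - v 0 := by
    rw [max_zero_max_add, h2]
    clear h2 h8 hN eM eN
    grind (splits := 20)
  have hB : max 0 (max (max 0 (v 0) - v 0 - v 1 - max 0 (v 2))
      (max (max 0 (v 0) - v 0 - v 1 - max 0 (v 2) + (v 5 + M - max 0 (v 0) - N))
        (max 0 (v 0) - v 0 - v 1 - max 0 (v 2) + (v 5 + M - max 0 (v 0) - N)
          + (max 0 (v 2) - v 2 - v 5)))) = M - v 0 - v 1 - v 2 := by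
    rw [max_zero_max_max_add, h8]
    clear h2 h8 hA hN eM eN
    grind (splits := 20)
  ext i
  fin_cases i <;> simp [Q1, Q1', eM, eN, h2, max_zero_neg, h8, hA, hB] <;> ring

/-- `Q₁'` is a two-sided inverse of `Q₁`: `Q₁' ∘ Q₁ = id` and `Q₁ ∘ Q₁' = id`. -/
theorem stmt_9 : Q1' ∘ Q1 = id ∧ Q1 ∘ Q1' = id := by
  exact ⟨funext Q1'_Q1, funext Q1_Q1'⟩
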